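/- Let 𝒯 be a stubborn set assignment satisfying D0, D1 and D2. Suppose there exists a reachable state from which no terminal state is reachable, but some terminal state is reachable from the initial state ŝ. Then there exists an r-state s̃ from which no terminal state is reachable. -/

import Mathlib

/-- `TPath step s σ s'` means `s →[σ] s'`: firing the sequence `σ` of transitions
from `s` yields `s'`. -/
inductive TPath {S T : Type*} (step : S → T → S → Prop) : S → List T → S → Prop
  | nil (s : S) : TPath step s [] s
  | cons {s s' s'' : S} {t : T} {σ : List T} :
      step s t s' → TPath step s' σ s'' → TPath step s (t :: σ) s''

/-- Transition `t` is enabled at `s`. -/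
def Enabled {S T : Type*} (step : S → T → S → Prop) (s : S) (t : T) : Prop :=
  ∃ s', step s t s'

/-- A state is terminal iff no transition is enabled at it. -/
def Terminal {S T : Type*} (step : S → T → S → Prop) (s : S) : Prop :=
  ∀ t, ¬ Enabled step s t

/-- `s'` is reachable from `s`. -/
def Reachable {S T : Type*} (step : S → T → S → Prop) (s s' : S) : Prop :=
  ∃ σ, TPath step s σ s'

/-- An r-edge: a step `s →[t] s'` with `t ∈ 𝒯 s`. -/
def REdge {S T : Type*} (step : S → T → S → Prop) (𝒯 : S → Set T)
    (s : S) (t : T) (s' : S) : Prop :=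
  step s t s' ∧ t ∈ 𝒯 s

/-- The transition relation is deterministic. -/
def Deterministic {S T : Type*} (step : S → T → S → Prop) : Prop :=
  ∀ s t s₁ s₂, step s t s₁ → step s t s₂ → s₁ = s₂

/-- D0: if `s₀` is not terminal then `𝒯 s₀` contains an enabled transition. -/
def D0 {S T : Type*} (step : S → T → S → Prop) (𝒯 : S → Set T) : Prop :=
  ∀ s₀, ¬ Terminal step s₀ → ∃ t ∈ 𝒯 s₀, Enabled step s₀ t

/-- D1: if `t ∈ 𝒯 s₀`, `t₁,…,tₙ ∉ 𝒯 s₀` and `s₀ →[t₁⋯tₙ t] s'`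
then `s₀ →[t t₁⋯tₙ] s'`. -/
def D1 {S T : Type*} (step : S → T → S → Prop) (𝒯 : S → Set T) : Prop :=
  ∀ s₀ t σ s', t ∈ 𝒯 s₀ → (∀ u ∈ σ, u ∉ 𝒯 s₀) →
    TPath step s₀ (σ ++ [t]) s' → TPath step s₀ (t :: σ) s'

/-- D2: if `t ∈ 𝒯 s₀` is enabled at `s₀`, `t₁,…,tₙ ∉ 𝒯 s₀` and `s₀ →[t₁⋯tₙ] sₙ`
then `t` is enabled at `sₙ`. -/
def D2 {S T : Type*} (step : S → T → S → Prop) (𝒯 : S → Set T) : Prop :=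
  ∀ s₀ t σ sₙ, t ∈ 𝒯 s₀ → Enabled step s₀ t → (∀ u ∈ σ, u ∉ 𝒯 s₀) →
    TPath step s₀ σ sₙ → Enabled step sₙ t

theorem TPath.append {S T : Type*} {step : S → T → S → Prop} {s s' s'' : S} {σ τ : List T}
    (h : TPath step s σ s') (h' : TPath step s' τ s'') : TPath step s (σ ++ τ) s'' := by
  induction h with
  | nil => exact h'
  | cons hst _ ih => exact .cons hst (ih h')

theorem TPath.exists_of_append {S T : Type*} {step : S → T → S → Prop} {s s'' : S} {σ τ : List T}
    (h : TPath step s (σ ++ τ) s'') : ∃ s', TPath step s σ s' ∧ TPath step s' τ s'' := by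
  induction σ generalizing s with
  | nil => exact ⟨s, .nil s, h⟩
  | cons t σ ih =>
    cases h with
    | cons hst h =>
      obtain ⟨s', h₁, h₂⟩ := ih h
      exact ⟨s', .cons hst h₁, h₂⟩

theorem List.exists_append_cons_first_mem {T : Type*} (P : Set T) {σ : List T}
    (h : ∃ u ∈ σ, u ∈ P) :
    ∃ α t β, σ = α ++ t :: β ∧ t ∈ P ∧ ∀ u ∈ α, u ∉ P := by
  induction σ with
  | nil => simp at h
  | cons a σ ih =>
    by_cases ha : a ∈ P
    · exact ⟨[], a, σ, rfl, ha, by simp⟩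
    · obtain ⟨u, hu, huP⟩ := h
      have huσ : u ∈ σ := (List.mem_cons.1 hu).resolve_left fun e => ha (e ▸ huP)
      obtain ⟨α, t, β, rfl, ht, hα⟩ := ih ⟨u, huσ, huP⟩
      exact ⟨a :: α, t, β, rfl, ht, by simpa using ⟨ha, hα⟩⟩

theorem Reachable.of_step {S T : Type*} {step : S → T → S → Prop} {s s' s'' : S} {t : T}
    (h : step s t s') : Reachable step s' s'' → Reachable step s s''
  | ⟨σ, hσ⟩ => ⟨t :: σ, .cons h hσ⟩

/-- A path that fires an element of `𝒯 s` can be rearranged to start with an r-edge. -/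
theorem D1.exists_rEdge {S T : Type*} {step : S → T → S → Prop} {𝒯 : S → Set T}
    (h1 : D1 step 𝒯) {s s' : S} {σ : List T} (hσ : TPath step s σ s')
    (hmem : ∃ u ∈ σ, u ∈ 𝒯 s) :
    ∃ t s₁ τ, REdge step 𝒯 s t s₁ ∧ TPath step s₁ τ s' ∧ τ.length + 1 = σ.length := by
  obtain ⟨α, t, β, rfl, ht, hα⟩ := List.exists_append_cons_first_mem (𝒯 s) hmem
  rw [List.append_cons] at hσ
  obtain ⟨m, hm, hβ⟩ := hσ.exists_of_append
  cases h1 s t α m ht hα hm with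
  | cons hst h => exact ⟨t, _, α ++ β, ⟨hst, ht⟩, h.append hβ, by simp; omega⟩

/-- A path to a terminal state fires an element of the stubborn set, unless it starts in a
terminal state. -/
theorem D2.exists_mem_of_terminal {S T : Type*} {step : S → T → S → Prop} {𝒯 : S → Set T}
    (h0 : D0 step 𝒯) (h2 : D2 step 𝒯) {s s' : S} {ρ : List T} (hs : ¬ Terminal step s)
    (hs' : Terminal step s') (hρ : TPath step s ρ s') : ∃ u ∈ ρ, u ∈ 𝒯 s := by
  by_contra! hno
  obtain ⟨t, ht, hen⟩ := h0 s hs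
  exact hs' t (h2 s t ρ s' ht hen hno hρ)

/-- A path avoiding `𝒯 s` commutes with any r-edge leaving `s`. -/
theorem REdge.exists_tPath_step {S T : Type*} {step : S → T → S → Prop} {𝒯 : S → Set T}
    (hdet : Deterministic step) (h1 : D1 step 𝒯) (h2 : D2 step 𝒯) {s s₁ s' : S} {t : T}
    {σ : List T} (he : REdge step 𝒯 s t s₁) (hσ : TPath step s σ s')
    (hno : ∀ u ∈ σ, u ∉ 𝒯 s) : ∃ s'', TPath step s₁ σ s'' ∧ step s' t s'' := by
  obtain ⟨s'', hs''⟩ := h2 s t σ s' he.2 ⟨s₁, he.1⟩ hno hσ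
  cases h1 s t σ s'' he.2 hno (hσ.append (.cons hs'' (.nil s''))) with
  | cons hst h => exact ⟨s'', hdet _ _ _ _ hst he.1 ▸ h, hs''⟩

/-- If a state without reachable terminal states is reachable, then one is reachable along
r-edges. -/
theorem exists_rEdge_reachable_no_terminal {S T : Type*} {step : S → T → S → Prop}
    {𝒯 : S → Set T} (hdet : Deterministic step) (h0 : D0 step 𝒯) (h1 : D1 step 𝒯)
    (h2 : D2 step 𝒯) {s d : S} {σ : List T} (hσ : TPath step s σ d)
    (hd : ∀ e, Terminal step e → ¬ Reachable step d e) :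
    ∃ r, Reachable (REdge step 𝒯) s r ∧ ∀ e, Terminal step e → ¬ Reachable step r e := by
  induction hn : σ.length generalizing s d σ with
  | zero =>
    obtain rfl := List.length_eq_zero_iff.1 hn
    cases hσ
    exact ⟨_, ⟨[], .nil _⟩, hd⟩
  | succ n ihσ =>
    by_cases hs : ∀ e, Terminal step e → ¬ Reachable step s e
    · exact ⟨s, ⟨[], .nil s⟩, hs⟩
    push Not at hs
    obtain ⟨e, he, ρ, hρ⟩ := hs
    induction hm : ρ.length using Nat.strong_induction_on generalizing s d σ ρ with
    | _ m ihρ =>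
      by_cases hmem : ∃ u ∈ σ, u ∈ 𝒯 s
      · obtain ⟨t, s₁, τ, hedge, hτ, hlen⟩ := h1.exists_rEdge hσ hmem
        obtain ⟨r, hr, hr'⟩ := ihσ hτ hd (by omega)
        exact ⟨r, hr.of_step hedge, hr'⟩
      · push Not at hmem
        have hs : ¬ Terminal step s := by
          cases hσ with
          | nil => simp at hn
          | cons hst _ => exact fun h => h _ ⟨_, hst⟩
        obtain ⟨t, s₁, τ, hedge, hτ, hlen⟩ :=
          h1.exists_rEdge hρ (h2.exists_mem_of_terminal h0 hs he hρ)
        obtain ⟨d', hσ', hd'⟩ := hedge.exists_tPath_step hdet h1 h2 hσ hmem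
        obtain ⟨r, hr, hr'⟩ := ihρ τ.length (by omega) hσ'
          (fun e he h => hd e he (h.of_step hd')) hn τ hτ rfl
        exact ⟨r, hr.of_step hedge, hr'⟩

/-- Third case of the proof of Theorem 2: if some reachable state has no terminal
state reachable from it, but some terminal state is reachable from `sHat`, then
there is an r-state from which no terminal state is reachable. -/
theorem stmt8 {S T : Type*} (step : S → T → S → Prop) (𝒯 : S → Set T) (sHat : S)
    (hdet : Deterministic step) (h0 : D0 step 𝒯) (h1 : D1 step 𝒯) (h2 : D2 step 𝒯)
    (hbad : ∃ s, Reachable step sHat s ∧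
      ∀ s_t, Terminal step s_t → ¬ Reachable step s s_t)
    (hterm : ∃ s_t, Terminal step s_t ∧ Reachable step sHat s_t) :
    ∃ sTilde, Reachable (REdge step 𝒯) sHat sTilde ∧
      ∀ s_t, Terminal step s_t → ¬ Reachable step sTilde s_t := by
  obtain ⟨d, ⟨σ, hσ⟩, hd⟩ := hbad
  exact exists_rEdge_reachable_no_terminal hdet h0 h1 h2 hσ hd
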